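/- There exists a constant C > 0 with the following property. Let d ≤ n and let A be a nonzero n×n real symmetric matrix with spectral representation A = U_A S_A U_Aᵀ + Ỹ M Ỹᵀ, where U_A is n×d, Ỹ is n×(n−d), the n×n matrix [U_A Ỹ] is orthogonal, S_A is the d×d diagonal matrix of the d largest-in-magnitude eigenvalues of A, and M is the (n−d)×(n−d) diagonal matrix of the remaining n−d eigenvalues of A. Let Û be an n×d real matrix with orthonormal columns and Ŝ a d×d real symmetric matrix, and let ρ = min{ |μ − ν| : μ an eigenvalue of Ŝ, ν a diagonal entry of M }; assume ρ > 0. Then there exists a d×d real orthogonal matrix W₂ such that for every ε > 0, if ‖A Û − Û Ŝ‖₂ / ‖A‖₂ ≤ ε, then ‖Û − U_A W₂‖_F / ‖A‖₂ ≤ C √d · ε / ρ. -/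

import Mathlib

open scoped BigOperators
open Matrix

/-- The Frobenius norm of a real matrix. -/
noncomputable def frobNorm {m n : Type*} [Fintype m] [Fintype n] (M : Matrix m n ℝ) : ℝ :=
  Real.sqrt (∑ i, ∑ j, (M i j) ^ 2)

/-- The spectral norm (largest singular value) of a real matrix, realized as the
`ℓ²`-operator norm of the associated linear map between Euclidean spaces. -/
noncomputable def specNorm {m n : ℕ} (M : Matrix (Fin m) (Fin n) ℝ) : ℝ :=
  ‖LinearMap.toContinuousLinearMap (Matrix.toEuclideanLin M)‖

lemma aux_trace_sq {m n : Type*} [Fintype m] [Fintype n] (X : Matrix m n ℝ) :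
    ∑ i, ∑ j, (X i j) ^ 2 = (Xᵀ * X).trace := by
  rw [Finset.sum_comm]
  simp [Matrix.trace, Matrix.mul_apply, pow_two]

lemma aux_trace_nonneg {m n : Type*} [Fintype m] [Fintype n] (X : Matrix m n ℝ) :
    0 ≤ (Xᵀ * X).trace := by
  rw [← aux_trace_sq]; positivity

lemma aux_diag {d : ℕ} (S : Matrix (Fin d) (Fin d) ℝ) (hS : S.IsHermitian) :
    ∃ V : Matrix (Fin d) (Fin d) ℝ, Vᵀ * V = 1 ∧ V * Vᵀ = 1 ∧
      S * V = V * Matrix.diagonal hS.eigenvalues := by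
  have h1 : (hS.eigenvectorUnitary : Matrix (Fin d) (Fin d) ℝ)ᵀ * hS.eigenvectorUnitary = 1 := by
    have := Unitary.coe_star_mul_self hS.eigenvectorUnitary
    rwa [Matrix.star_eq_conjTranspose, Matrix.conjTranspose_eq_transpose_of_trivial] at this
  refine ⟨hS.eigenvectorUnitary, h1, mul_eq_one_comm.mp h1, ?_⟩
  have h := hS.spectral_theorem
  rw [Unitary.conjStarAlgAut_apply, Matrix.star_eq_conjTranspose,
    Matrix.conjTranspose_eq_transpose_of_trivial] at h
  have h' := congrArg (fun X => X * (hS.eigenvectorUnitary : Matrix (Fin d) (Fin d) ℝ)) h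
  simp only [Matrix.mul_assoc, h1, Matrix.mul_one] at h'
  exact h'

/-- Completing orthogonal columns to an orthogonal matrix. -/
lemma aux_complete {d : ℕ} (L : Matrix (Fin d) (Fin d) ℝ) (D : Fin d → ℝ)
    (hL : Lᵀ * L = Matrix.diagonal D) (hD : ∀ i, D i ≤ 1) :
    ∃ Q : Matrix (Fin d) (Fin d) ℝ, Qᵀ * Q = 1 ∧ ∑ i, D i ≤ (Qᵀ * L).trace := by
  have hin : ∀ i j, ∑ k, L k i * L k j = if i = j then D i else 0 := by
    intro i j
    have := congrFun (congrFun hL i) j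
    simpa [Matrix.mul_apply, Matrix.diagonal_apply] using this
  have hD0 : ∀ i, 0 ≤ D i := by
    intro i
    have := hin i i
    simp only [if_true] at this
    rw [← this]
    exact Finset.sum_nonneg fun k _ => mul_self_nonneg _
  let v : Fin d → EuclideanSpace ℝ (Fin d) :=
    fun i => WithLp.toLp 2 (fun k => (Real.sqrt (D i))⁻¹ * L k i)
  have hv : ∀ i j, inner ℝ (v i) (v j) =
      (Real.sqrt (D i))⁻¹ * (Real.sqrt (D j))⁻¹ * (if i = j then D i else 0) := by
    intro i j
    rw [← hin i j, Finset.mul_sum]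
    simp only [v, PiLp.inner_apply]
    refine Finset.sum_congr rfl fun k _ => ?_
    simp
    ring
  have horth : Orthonormal ℝ (Set.domRestrict {i | D i ≠ 0} v) := by
    rw [orthonormal_iff_ite]
    rintro ⟨i, hi⟩ ⟨j, hj⟩
    have h0 : 0 < D i := lt_of_le_of_ne (hD0 i) (Ne.symm hi)
    change inner ℝ (v i) (v j) = _
    rw [hv]
    by_cases hij : i = j
    · subst hij
      simp only [if_true]
      rw [← mul_inv, Real.mul_self_sqrt h0.le, inv_mul_cancel₀ h0.ne']
    · simp [hij]
  obtain ⟨b, hb⟩ := horth.exists_orthonormalBasis_extension_of_card_eq (by simp)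
  refine ⟨Matrix.of fun k i => b i k, ?_, ?_⟩
  · ext i j
    have := orthonormal_iff_ite.mp b.orthonormal i j
    rw [PiLp.inner_apply] at this
    simp only [Matrix.mul_apply, Matrix.one_apply, Matrix.transpose_apply, Matrix.of_apply]
    rw [← this]
    refine Finset.sum_congr rfl fun k _ => ?_
    simp [mul_comm]
  · simp only [Matrix.trace, Matrix.diag_apply, Matrix.mul_apply, Matrix.transpose_apply,
      Matrix.of_apply]
    refine Finset.sum_le_sum fun i _ => ?_
    have hii := hin i i
    simp only [if_true] at hii
    by_cases h0 : D i = 0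
    · rw [h0] at hii
      have hz := (Finset.sum_eq_zero_iff_of_nonneg
        (fun k _ => mul_self_nonneg (L k i))).mp hii
      rw [h0]
      refine (Finset.sum_eq_zero fun k hk => ?_).ge
      rw [mul_self_eq_zero.mp (hz k hk), mul_zero]
    · have hp : 0 < D i := lt_of_le_of_ne (hD0 i) (Ne.symm h0)
      have e : ∑ k, b i k * L k i = (Real.sqrt (D i))⁻¹ * D i := by
        rw [hb i h0]
        have : (Real.sqrt (D i))⁻¹ * D i = (Real.sqrt (D i))⁻¹ * ∑ k, L k i * L k i := by rw [hii]
        rw [this, Finset.mul_sum]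
        refine Finset.sum_congr rfl fun k _ => ?_
        simp only [v]
        ring
      rw [e]
      have hs : 0 < Real.sqrt (D i) := Real.sqrt_pos.mpr hp
      have hs1 : Real.sqrt (D i) ≤ 1 := Real.sqrt_le_one.mpr (hD i)
      have : 1 ≤ (Real.sqrt (D i))⁻¹ := (one_le_inv₀ hs).mpr hs1
      nlinarith

/-- Polar factor: for a contraction `K` there is orthogonal `W` with `tr(Wᵀ K) ≥ tr(Kᵀ K)`. -/
lemma aux_polar {d k : ℕ} (K : Matrix (Fin d) (Fin d) ℝ) (Z : Matrix (Fin k) (Fin d) ℝ)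
    (hKZ : Kᵀ * K + Zᵀ * Z = 1) :
    ∃ W : Matrix (Fin d) (Fin d) ℝ, Wᵀ * W = 1 ∧ (Kᵀ * K).trace ≤ (Wᵀ * K).trace := by
  have hH : (Kᵀ * K).IsHermitian := by
    simp [Matrix.IsHermitian, Matrix.conjTranspose_eq_transpose_of_trivial]
  obtain ⟨V, h1, h2, h3⟩ := aux_diag _ hH
  set D := hH.eigenvalues
  have hL : (K * V)ᵀ * (K * V) = Matrix.diagonal D := by
    rw [Matrix.transpose_mul, Matrix.mul_assoc, ← Matrix.mul_assoc Kᵀ, h3, ← Matrix.mul_assoc, h1,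
      Matrix.one_mul]
  have hZ : Matrix.diagonal D + (Z * V)ᵀ * (Z * V) = 1 := by
    rw [← hL, Matrix.transpose_mul, Matrix.transpose_mul]
    calc Vᵀ * Kᵀ * (K * V) + Vᵀ * Zᵀ * (Z * V) = Vᵀ * (Kᵀ * K + Zᵀ * Z) * V := by
          simp only [Matrix.mul_add, Matrix.add_mul, Matrix.mul_assoc]
      _ = 1 := by rw [hKZ, Matrix.mul_one, h1]
  have hD : ∀ i, D i ≤ 1 := by
    intro i
    have := congrFun (congrFun hZ i) i
    simp only [Matrix.add_apply, Matrix.diagonal_apply_eq, Matrix.one_apply_eq] at this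
    have h0 : 0 ≤ ((Z * V)ᵀ * (Z * V)) i i := by
      rw [Matrix.mul_apply]
      exact Finset.sum_nonneg fun k _ => mul_self_nonneg _
    linarith
  obtain ⟨Q, hQ, hQL⟩ := aux_complete _ D hL hD
  refine ⟨Q * Vᵀ, ?_, ?_⟩
  · rw [Matrix.transpose_mul, Matrix.transpose_transpose, Matrix.mul_assoc, ← Matrix.mul_assoc Qᵀ,
      hQ, Matrix.one_mul, h2]
  · have e1 : (Kᵀ * K).trace = ∑ i, D i := by
      rw [← Matrix.trace_diagonal, ← hL, Matrix.transpose_mul, Matrix.mul_assoc,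
        Matrix.trace_mul_comm Vᵀ, Matrix.mul_assoc, Matrix.mul_assoc, h2, Matrix.mul_one]
    rw [e1, Matrix.transpose_mul, Matrix.transpose_transpose, Matrix.mul_assoc,
      Matrix.trace_mul_comm, Matrix.mul_assoc]
    exact hQL

lemma aux_spec {n d : ℕ} (R : Matrix (Fin n) (Fin d) ℝ) :
    (Rᵀ * R).trace ≤ d * specNorm R ^ 2 := by
  rw [← aux_trace_sq, Finset.sum_comm]
  have : ∀ j : Fin d, ∑ i, (R i j) ^ 2 ≤ specNorm R ^ 2 := by
    intro j
    have h := (LinearMap.toContinuousLinearMap (Matrix.toEuclideanLin R)).le_opNorm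
      (EuclideanSpace.single j (1 : ℝ))
    have h2 : ‖(LinearMap.toContinuousLinearMap (Matrix.toEuclideanLin R))
      (EuclideanSpace.single j (1 : ℝ))‖ ^ 2 = ∑ i, (R i j) ^ 2 := by
      rw [EuclideanSpace.norm_sq_eq]
      simp [Matrix.toLpLin_apply]
    rw [← h2]
    simp only [EuclideanSpace.norm_single, norm_one, mul_one] at h
    exact pow_le_pow_left₀ (norm_nonneg _) h 2
  calc _ ≤ ∑ _j : Fin d, specNorm R ^ 2 := Finset.sum_le_sum fun j _ => this j
    _ = _ := by simp

lemma aux_sylvester {k d : ℕ} (Z : Matrix (Fin k) (Fin d) ℝ) (m : Fin k → ℝ)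
    (S : Matrix (Fin d) (Fin d) ℝ) (hS : S.IsHermitian) (ρ : ℝ) (hρ : 0 < ρ)
    (h : ∀ (i : Fin d) (j : Fin k), ρ ≤ |hS.eigenvalues i - m j|) :
    ρ ^ 2 * (Zᵀ * Z).trace ≤
      ((Matrix.diagonal m * Z - Z * S)ᵀ * (Matrix.diagonal m * Z - Z * S)).trace := by
  obtain ⟨V, h1, h2, h3⟩ := aux_diag S hS
  have inv : ∀ X : Matrix (Fin k) (Fin d) ℝ,
      (Xᵀ * X).trace = ((X * V)ᵀ * (X * V)).trace := by
    intro X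
    rw [Matrix.transpose_mul, Matrix.mul_assoc, Matrix.trace_mul_comm Vᵀ, Matrix.mul_assoc,
      Matrix.mul_assoc, h2, Matrix.mul_one]
  rw [inv Z, inv (_ - _), Matrix.sub_mul, Matrix.mul_assoc Z S V, h3, ← Matrix.mul_assoc Z V,
    Matrix.mul_assoc _ Z V, ← aux_trace_sq, ← aux_trace_sq, Finset.mul_sum]
  refine Finset.sum_le_sum fun j _ => ?_
  rw [Finset.mul_sum]
  refine Finset.sum_le_sum fun i _ => ?_
  rw [Matrix.sub_apply, Matrix.diagonal_mul, Matrix.mul_diagonal]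
  have e : m j * (Z * V) j i - (Z * V) j i * hS.eigenvalues i =
    -((hS.eigenvalues i - m j) * (Z * V) j i) := by ring
  rw [e, neg_sq, mul_pow, ← sq_abs (hS.eigenvalues i - m j)]
  have := pow_le_pow_left₀ hρ.le (h i j) 2
  exact mul_le_mul_of_nonneg_right this (sq_nonneg _)

/-- There exists a constant `C > 0` with the following property.  Let `d ≤ n` and let `A` be a
nonzero `n × n` real symmetric matrix with spectral representation
`A = U_A S_A U_Aᵀ + Ỹ M Ỹᵀ`, where `[U_A Ỹ]` is orthogonal, `S_A = diag s` is the diagonal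
matrix of the `d` largest-in-magnitude eigenvalues of `A`, and `M = diag m` the diagonal matrix
of the remaining `n - d` eigenvalues.  Let `Û` be `n × d` with orthonormal columns, `Ŝ` a
`d × d` real symmetric matrix, and `ρ = min { |μ - ν| : μ ∈ Spec Ŝ, ν a diagonal entry of M }`,
with `ρ > 0`.  Then there is a `d × d` orthogonal `W₂` such that for every `ε > 0`, if
`‖A Û - Û Ŝ‖₂ / ‖A‖₂ ≤ ε` then `‖Û - U_A W₂‖_F / ‖A‖₂ ≤ C √d ε / ρ`. -/
theorem stopping_criterion_eigvec_error :
    ∃ C : ℝ, 0 < C ∧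
      ∀ (n d : ℕ), d ≤ n →
      ∀ (A : Matrix (Fin n) (Fin n) ℝ), A ≠ 0 → Aᵀ = A →
      ∀ (UA : Matrix (Fin n) (Fin d) ℝ) (Y : Matrix (Fin n) (Fin (n - d)) ℝ)
        (s : Fin d → ℝ) (m : Fin (n - d) → ℝ),
        UAᵀ * UA = 1 → Yᵀ * Y = 1 → UAᵀ * Y = 0 → UA * UAᵀ + Y * Yᵀ = 1 →
        A = UA * Matrix.diagonal s * UAᵀ + Y * Matrix.diagonal m * Yᵀ →
        (∀ (i : Fin d) (j : Fin (n - d)), |m j| ≤ |s i|) →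
      ∀ (Uhat : Matrix (Fin n) (Fin d) ℝ), Uhatᵀ * Uhat = 1 →
      ∀ (Shat : Matrix (Fin d) (Fin d) ℝ) (hShat : Shat.IsHermitian),
      ∀ ρ : ℝ, 0 < ρ →
        (∀ (i : Fin d) (j : Fin (n - d)), ρ ≤ |hShat.eigenvalues i - m j|) →
        (∃ (i : Fin d) (j : Fin (n - d)), ρ = |hShat.eigenvalues i - m j|) →
        ∃ W₂ : Matrix (Fin d) (Fin d) ℝ, W₂ᵀ * W₂ = 1 ∧
          ∀ ε : ℝ, 0 < ε →
            specNorm (A * Uhat - Uhat * Shat) / specNorm A ≤ ε →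
            frobNorm (Uhat - UA * W₂) / specNorm A ≤ C * Real.sqrt d * ε / ρ := by
  refine ⟨Real.sqrt 2, by positivity, ?_⟩
  intro n d _ A hA0 _ UA Y s m hUU hYY hUY hI hA _ Uhat hUh S hS ρ hρ hgap _
  have hYU : Yᵀ * UA = 0 := by
    have := congrArg Matrix.transpose hUY
    simpa [Matrix.transpose_mul] using this
  have split : ∀ X : Matrix (Fin n) (Fin d) ℝ,
      (UAᵀ * X)ᵀ * (UAᵀ * X) + (Yᵀ * X)ᵀ * (Yᵀ * X) = Xᵀ * X := by
    intro X
    calc _ = Xᵀ * (UA * UAᵀ + Y * Yᵀ) * X := by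
          simp only [Matrix.transpose_mul, Matrix.transpose_transpose, Matrix.mul_add,
            Matrix.add_mul, Matrix.mul_assoc]
      _ = _ := by rw [hI, Matrix.mul_one]
  have hKZ := split Uhat
  rw [hUh] at hKZ
  obtain ⟨W, hW, hWt⟩ := aux_polar _ _ hKZ
  refine ⟨W, hW, ?_⟩
  intro ε hε hres
  have hA : 0 < specNorm A := by
    rw [specNorm, norm_pos_iff]
    simpa using hA0
  set R := A * Uhat - Uhat * S with hR
  have hYA : Yᵀ * A = Matrix.diagonal m * Yᵀ := by
    rw [‹A = _›, Matrix.mul_add]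
    simp only [← Matrix.mul_assoc, hYU, hYY, Matrix.zero_mul, Matrix.one_mul, zero_add]
  have hYR : Yᵀ * R = Matrix.diagonal m * (Yᵀ * Uhat) - (Yᵀ * Uhat) * S := by
    rw [hR, Matrix.mul_sub, ← Matrix.mul_assoc, hYA, Matrix.mul_assoc, Matrix.mul_assoc]
  have hsyl := aux_sylvester (Yᵀ * Uhat) m S hS ρ hρ hgap
  rw [← hYR] at hsyl
  have hRt := congrArg Matrix.trace (split R)
  rw [Matrix.trace_add] at hRt
  have h0 := aux_trace_nonneg (UAᵀ * R)
  have hsp := aux_spec R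
  have hKt := congrArg Matrix.trace hKZ
  rw [Matrix.trace_add] at hKt
  have hexp : ((Uhat - UA * W)ᵀ * (Uhat - UA * W)).trace
      = 2 * (1 : Matrix (Fin d) (Fin d) ℝ).trace - 2 * (Wᵀ * (UAᵀ * Uhat)).trace := by
    have e1 : (UA * W)ᵀ * (UA * W) = 1 := by
      rw [Matrix.transpose_mul, Matrix.mul_assoc, ← Matrix.mul_assoc UAᵀ, hUU, Matrix.one_mul, hW]
    have e2 : (Uhatᵀ * (UA * W)).trace = (Wᵀ * (UAᵀ * Uhat)).trace := by
      rw [← Matrix.trace_transpose]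
      simp only [Matrix.transpose_mul, Matrix.transpose_transpose, Matrix.mul_assoc]
    have e3 : ((UA * W)ᵀ * Uhat).trace = (Wᵀ * (UAᵀ * Uhat)).trace := by
      rw [Matrix.transpose_mul, Matrix.mul_assoc]
    rw [Matrix.transpose_sub, Matrix.sub_mul, Matrix.mul_sub, Matrix.mul_sub, hUh, e1,
      Matrix.trace_sub, Matrix.trace_sub, Matrix.trace_sub, e2, e3]
    ring
  have hr : specNorm R ≤ ε * specNorm A := (div_le_iff₀ hA).mp hres
  have hr0 : 0 ≤ specNorm R := norm_nonneg _
  have hr2 : specNorm R ^ 2 ≤ (ε * specNorm A) ^ 2 := pow_le_pow_left₀ hr0 hr 2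
  have hd : (0 : ℝ) ≤ d := Nat.cast_nonneg d
  have key : ρ ^ 2 * ((Uhat - UA * W)ᵀ * (Uhat - UA * W)).trace
      ≤ 2 * d * (ε * specNorm A) ^ 2 := by
    have a1 : ((Uhat - UA * W)ᵀ * (Uhat - UA * W)).trace
      ≤ 2 * ((Yᵀ * Uhat)ᵀ * (Yᵀ * Uhat)).trace := by rw [hexp]; linarith
    have a2 := mul_le_mul_of_nonneg_left a1 (sq_nonneg ρ)
    have a3 := mul_le_mul_of_nonneg_left hr2 hd
    linarith
  have hfin : frobNorm (Uhat - UA * W) ≤ Real.sqrt 2 * Real.sqrt d * (ε * specNorm A) / ρ := by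
    rw [frobNorm, aux_trace_sq]
    apply Real.sqrt_le_iff.mpr
    refine ⟨by positivity, ?_⟩
    rw [div_pow, mul_pow, mul_pow, Real.sq_sqrt (by norm_num), Real.sq_sqrt hd,
      le_div_iff₀ (by positivity)]
    linarith
  rw [div_le_iff₀ hA]
  refine hfin.trans (le_of_eq ?_)
  ring
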